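/- Let 0 < s < 1/2. Let δ_n be a positive sequence with δ_n → 0, set Λ_n = 1/δ_n, let T_n = L_n(Λ_n+1)δ_n with L_n a positive integer, and let u_n be a minimizer of ℱ^{T_n}_s over 𝒜^{T_n,Λ_n,δ_n}. Then lim_{n→∞} ℱ^{T_n}_s(u_n) = (1/2) ∫_0^1 ∫_ℝ |w(x)−w(y)|²/|x−y|^{1+2s} dy dx, where w(x) = x − ⌊x⌋ is the mantissa (fractional part) function. -/

import Mathlib

open MeasureTheory Filter Set Topology

noncomputable section

/-- A function `u : ℝ → ℝ` is piecewise affine: it is affine in a neighborhood of every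
point outside a closed discrete set (the corner set). -/
def PiecewiseAffine (u : ℝ → ℝ) : Prop :=
  ∃ S : Set ℝ, IsClosed S ∧ (∀ x ∈ S, ∃ ε > 0, S ∩ Set.Ioo (x - ε) (x + ε) ⊆ {x}) ∧
    ∀ x ∉ S, ∃ ε > 0, ∃ m q : ℝ, ∀ y : ℝ, |y - x| < ε → u y = m * y + q

/-- The admissible class `𝒜^{T,Λ,δ}`: continuous, `T`-periodic, piecewise affine functions
with slope in `{1, -Λ}` a.e., such that the region where the slope is `-Λ` is a union of
intervals of length `δ` whose pairwise intersections contain at most one point. -/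
structure Admissible (T Λ δ : ℝ) (u : ℝ → ℝ) : Prop where
  cont : Continuous u
  per : Function.Periodic u T
  pwAffine : PiecewiseAffine u
  slopes : ∀ᵐ x : ℝ ∂volume, HasDerivAt u 1 x ∨ HasDerivAt u (-Λ) x
  negRegion : ∃ a : ℕ → ℝ,
    (∀ k : ℕ, Set.Ioo (a k) (a k + δ) ⊆ {x : ℝ | HasDerivAt u (-Λ) x}) ∧
    ({x : ℝ | HasDerivAt u (-Λ) x} ⊆ ⋃ k : ℕ, Set.Icc (a k) (a k + δ)) ∧
    (Pairwise fun i j : ℕ =>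
      (Set.Icc (a i) (a i + δ) ∩ Set.Icc (a j) (a j + δ)).Subsingleton)

/-- The `s`-fractional Gagliardo seminorm energy density
`ℱ^T_s(u) = (1/(2T)) ∫_0^T ∫_ℝ |u(x)-u(y)|²/|x-y|^{1+2s} dy dx`. -/
def Fs (s T : ℝ) (u : ℝ → ℝ) : ℝ :=
  (1 / (2 * T)) * ∫ x in Set.Ioo (0 : ℝ) T, ∫ y : ℝ, (u x - u y) ^ 2 / |x - y| ^ (1 + 2 * s)

/-- The `s`-fractional Laplacian
`(-Δ)^s u (x) = 2 lim_{r→0⁺} ∫_{ℝ∖(x-r,x+r)} (u(x)-u(y))/|x-y|^{1+2s} dy`. -/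
def fracLap (s : ℝ) (u : ℝ → ℝ) (x : ℝ) : ℝ :=
  limUnder (𝓝[>] (0 : ℝ)) fun r : ℝ =>
    2 * ∫ y in {y : ℝ | r ≤ |x - y|}, (u x - u y) / |x - y| ^ (1 + 2 * s)

/-- The function `ū`: the `(Λ+1)δ`-periodic function equal to `-Λx` on `(-δ,0)` and to
`x` on `[0,Λδ]`. -/
def ubar (Λ δ : ℝ) (x : ℝ) : ℝ :=
  let y := ((Λ + 1) * δ) * Int.fract ((x + δ) / ((Λ + 1) * δ)) - δ
  if y < 0 then -Λ * y else y

/-- The extremal energy for `s = 0`: `ℱ^T_0(u) = (1/(2T)) ∫_0^T |u(x)|² dx`. -/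
def F0 (T : ℝ) (u : ℝ → ℝ) : ℝ :=
  (1 / (2 * T)) * ∫ x in Set.Ioo (0 : ℝ) T, (u x) ^ 2

/-- The extremal energy for `s = 1`: `ℱ^T_1(u) = (1/(2T)) ∫_0^T |u'(x)|² dx`. -/
def F1 (T : ℝ) (u : ℝ → ℝ) : ℝ :=
  (1 / (2 * T)) * ∫ x in Set.Ioo (0 : ℝ) T, (deriv u x) ^ 2

lemma countable_of_isolated {S : Set ℝ}
    (hS : ∀ x ∈ S, ∃ ε > 0, S ∩ Set.Ioo (x - ε) (x + ε) ⊆ {x}) : S.Countable := by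
  have : DiscreteTopology S := by
    refine discreteTopology_iff_isOpen_singleton.2 fun x => ?_
    obtain ⟨ε, hε, h⟩ := hS x x.2
    refine isOpen_induced_iff.2 ⟨Ioo (x - ε) (x + ε), isOpen_Ioo, ?_⟩
    ext y
    constructor
    · intro hy
      exact Subtype.ext (h ⟨y.2, hy⟩)
    · rintro rfl
      exact ⟨by simp [hε], by simp [hε]⟩
  exact (TopologicalSpace.separableSpace_iff_countable (α := S)).1 inferInstance

lemma hasDerivAt_of_eq_affine {u : ℝ → ℝ} {x ε m q : ℝ} (hε : 0 < ε)
    (h : ∀ y : ℝ, |y - x| < ε → u y = m * y + q) : HasDerivAt u m x := by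
  have h1 : HasDerivAt (fun y : ℝ => m * y + q) m x := by
    simpa using ((hasDerivAt_id x).const_mul m).add_const q
  refine h1.congr_of_eventuallyEq ?_
  filter_upwards [Metric.ball_mem_nhds x hε] with y hy
  exact h y (by simpa [Real.dist_eq] using hy)

lemma PiecewiseAffine.exists_countable {u : ℝ → ℝ} (hu : PiecewiseAffine u) :
    ∃ S : Set ℝ, S.Countable ∧ ∀ x ∉ S, DifferentiableAt ℝ u x := by
  obtain ⟨S, -, hS, h⟩ := hu
  refine ⟨S, countable_of_isolated hS, fun x hx => ?_⟩
  obtain ⟨ε, hε, m, q, hm⟩ := h x hx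
  exact (hasDerivAt_of_eq_affine hε hm).differentiableAt

/-- Since the slopes are a.e. `1` or `-Λ`, increments are determined by the measure of the
region of negative slope. -/
lemma Admissible.exists_increment {T Λ δ : ℝ} {u : ℝ → ℝ} (hu : Admissible T Λ δ u) :
    ∃ a : ℕ → ℝ,
      (Pairwise fun i j : ℕ => Disjoint (Ioo (a i) (a i + δ)) (Ioo (a j) (a j + δ))) ∧
      ∀ x y : ℝ, x ≤ y → u y - u x =
        (y - x) - (Λ + 1) * volume.real ((⋃ k, Ioo (a k) (a k + δ)) ∩ Ioc x y) := by
  obtain ⟨a, ha, hcov, hpair⟩ := hu.negRegion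
  refine ⟨a, fun i j hij => ?_, fun x y hxy => ?_⟩
  · change Disjoint _ _
    rw [Set.disjoint_iff_inter_eq_empty, Set.Ioo_inter_Ioo]
    refine Set.Ioo_eq_empty fun hlt => ?_
    have hs : (Icc (a i) (a i + δ) ∩ Icc (a j) (a j + δ)).Subsingleton := hpair hij
    rw [Set.Icc_inter_Icc] at hs
    exact hlt.ne (hs (left_mem_Icc.2 hlt.le) (right_mem_Icc.2 hlt.le))
  · set N : Set ℝ := ⋃ k, Ioo (a k) (a k + δ) with hN
    have hNm : MeasurableSet N := MeasurableSet.iUnion fun k => measurableSet_Ioo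
    obtain ⟨S, hSc, hS⟩ := hu.pwAffine.exists_countable
    have hE : (Set.range a ∪ Set.range fun k => a k + δ).Countable :=
      (countable_range _).union (countable_range _)
    have hae : deriv u =ᵐ[volume] fun z => 1 - (Λ + 1) * N.indicator (fun _ => (1 : ℝ)) z := by
      filter_upwards [hu.slopes, hE.ae_notMem volume] with z hz hzE
      by_cases hzN : z ∈ N
      · obtain ⟨k, hk⟩ := mem_iUnion.1 hzN
        have : HasDerivAt u (-Λ) z := ha k hk
        rw [this.deriv, indicator_of_mem hzN]
        ring
      · rw [indicator_of_notMem hzN]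
        rcases hz with hz | hz
        · rw [hz.deriv]
          ring
        · exfalso
          obtain ⟨k, hk⟩ := mem_iUnion.1 (hcov hz)
          refine hzN (mem_iUnion.2 ⟨k, lt_of_le_of_ne hk.1 ?_, lt_of_le_of_ne hk.2 ?_⟩)
          · rintro rfl
            exact hzE (Or.inl ⟨k, rfl⟩)
          · rintro rfl
            exact hzE (Or.inr ⟨k, rfl⟩)
    have hi : IntervalIntegrable (N.indicator (fun _ => (1 : ℝ))) volume x y :=
      ⟨(integrableOn_const (by simp)).indicator hNm, (integrableOn_const (by simp)).indicator hNm⟩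
    have hi2 : IntervalIntegrable (fun z => 1 - (Λ + 1) * N.indicator (fun _ => (1 : ℝ)) z)
        volume x y := intervalIntegrable_const.sub (hi.const_mul _)
    have hftc := MeasureTheory.integral_eq_of_hasDerivAt_off_countable u (deriv u) (a := x) (b := y)
      hSc hu.cont.continuousOn (fun z hz => (hS z hz.2).hasDerivAt)
      (hi2.congr_ae (ae_restrict_of_ae hae.symm))
    rw [← hftc, intervalIntegral.integral_congr_ae (hae.mono fun z hz _ => hz),
      intervalIntegral.integral_sub intervalIntegrable_const (hi.const_mul _),
      intervalIntegral.integral_const_mul, intervalIntegral.integral_of_le hxy,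
      intervalIntegral.integral_of_le hxy, integral_indicator_const _ hNm]
    simp [hxy, measureReal_restrict_apply hNm]

lemma exists_nat_volume_real {a : ℕ → ℝ} {δ x y : ℝ} (hδ : 0 < δ)
    (ha : Pairwise fun i j : ℕ => Disjoint (Ioo (a i) (a i + δ)) (Ioo (a j) (a j + δ)))
    (hx : x ∉ ⋃ k, Ioo (a k) (a k + δ)) (hy : y ∉ ⋃ k, Ioo (a k) (a k + δ)) :
    ∃ m : ℕ, volume.real ((⋃ k, Ioo (a k) (a k + δ)) ∩ Ioc x y) = m * δ := by
  simp only [mem_iUnion, not_exists] at hx hy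
  set K : Set ℕ := {k | x ≤ a k ∧ a k + δ ≤ y} with hK
  have hterm : ∀ k, volume (Ioo (a k) (a k + δ) ∩ Ioc x y) =
      K.indicator (fun _ => ENNReal.ofReal δ) k := by
    intro k
    by_cases hk : k ∈ K
    · rw [indicator_of_mem hk, inter_eq_self_of_subset_left, Real.volume_Ioo]
      · simp
      · exact fun z hz => ⟨hk.1.trans_lt hz.1, hz.2.le.trans hk.2⟩
    · rw [indicator_of_notMem hk]
      convert measure_empty (μ := volume)
      refine eq_empty_of_forall_notMem fun z ⟨hz, hz'⟩ => hk ⟨?_, ?_⟩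
      · by_contra! h
        exact hx k ⟨h, hz'.1.trans hz.2⟩
      · by_contra! h
        exact hy k ⟨hz.1.trans_le hz'.2, h⟩
  have hvol : volume ((⋃ k, Ioo (a k) (a k + δ)) ∩ Ioc x y) =
      (K.encard : ENNReal) * ENNReal.ofReal δ := by
    rw [iUnion_inter, measure_iUnion (fun i j hij =>
      (ha hij).mono inter_subset_left inter_subset_left)
      (fun k => measurableSet_Ioo.inter measurableSet_Ioc)]
    simp_rw [hterm]
    rw [← tsum_subtype, ENNReal.tsum_set_const]
  have hfin : K.Finite := by
    by_contra hinf
    have hlt : volume ((⋃ k, Ioo (a k) (a k + δ)) ∩ Ioc x y) < ⊤ :=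
      (measure_mono inter_subset_right).trans_lt (by simp)
    rw [hvol, Set.encard_eq_top hinf] at hlt
    simp [ENNReal.top_mul, hδ] at hlt
  refine ⟨K.ncard, ?_⟩
  rw [measureReal_def, hvol, ← hfin.cast_ncard_eq]
  simp [hδ.le]

/-- Increments of `u` never exceed those of the identity, and they agree with them modulo
`(Λ + 1) * δ` outside a set whose density is `1 / (Λ + 1)`. -/
lemma Admissible.increment_structure {T Λ δ : ℝ} {u : ℝ → ℝ} (hu : Admissible T Λ δ u)
    (hT : 0 < T) (hΛ : 0 < Λ) (hδ : 0 < δ) :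
    (∀ x y : ℝ, x ≤ y → u y - u x ≤ y - x) ∧
    ∃ N : Set ℝ, MeasurableSet N ∧
      (∀ x ∉ N, ∀ y ∉ N, ∃ m : ℤ, u y - u x = (y - x) + m * ((Λ + 1) * δ)) ∧
      ∀ x : ℝ, volume.real (N ∩ Ioc x (x + T)) = T / (Λ + 1) := by
  obtain ⟨a, ha, hinc⟩ := hu.exists_increment
  refine ⟨fun x y hxy => ?_, ⋃ k, Ioo (a k) (a k + δ),
    MeasurableSet.iUnion fun k => measurableSet_Ioo, fun x hx y hy => ?_, fun x => ?_⟩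
  · rw [hinc x y hxy]
    have : 0 ≤ (Λ + 1) * volume.real ((⋃ k, Ioo (a k) (a k + δ)) ∩ Ioc x y) := by positivity
    linarith
  · rcases le_total x y with hxy | hxy
    · obtain ⟨m, hm⟩ := exists_nat_volume_real hδ ha hx hy
      refine ⟨-m, ?_⟩
      rw [hinc x y hxy, hm]
      push_cast
      ring
    · obtain ⟨m, hm⟩ := exists_nat_volume_real hδ ha hy hx
      refine ⟨m, ?_⟩
      have := hinc y x hxy
      rw [hm] at this
      push_cast
      linarith
  · have h := hinc x (x + T) (by linarith)
    rw [hu.per x] at h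
    rw [eq_div_iff (by positivity)]
    linarith

/-- The mean square over a period of the increment of `u` at distance `h`. -/
def meanSqIncrement (T : ℝ) (u : ℝ → ℝ) (h : ℝ) : ℝ :=
  (1 / T) * ∫ x in Set.Ioo (0 : ℝ) T, (u (x + h) - u x) ^ 2

lemma meanSqIncrement_nonneg {T : ℝ} (hT : 0 < T) (u : ℝ → ℝ) (h : ℝ) :
    0 ≤ meanSqIncrement T u h :=
  mul_nonneg (by positivity) (integral_nonneg fun x => sq_nonneg _)

lemma integrableOn_Ioo_of_bounded {f : ℝ → ℝ} {T C : ℝ} (hf : Measurable f) (hC : ∀ x, |f x| ≤ C) :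
    IntegrableOn f (Ioo 0 T) :=
  Measure.integrableOn_of_bounded (by simp) hf.aestronglyMeasurable
    (Eventually.of_forall fun x => by simpa using hC x)

lemma Function.Periodic.setIntegral_increment_eq_zero {u : ℝ → ℝ} {T M : ℝ}
    (hu : Function.Periodic u T)
    (hT : 0 < T) (hm : Measurable u) (hM : ∀ x, |u x| ≤ M) (h : ℝ) :
    ∫ x in Ioo 0 T, (u (x + h) - u x) = 0 := by
  rw [integral_sub (integrableOn_Ioo_of_bounded (by fun_prop) fun x => hM _)
    (integrableOn_Ioo_of_bounded hm hM), ← integral_Ioc_eq_integral_Ioo,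
    ← integral_Ioc_eq_integral_Ioo, ← intervalIntegral.integral_of_le hT.le,
    ← intervalIntegral.integral_of_le hT.le, intervalIntegral.integral_comp_add_right,
    zero_add, add_comm T h, hu.intervalIntegral_add_eq h 0, zero_add, sub_self]

lemma abs_sub_le_two_mul {u : ℝ → ℝ} {M : ℝ} (hM : ∀ x, |u x| ≤ M) (x y : ℝ) :
    |u x - u y| ≤ 2 * M :=
  (abs_sub _ _).trans (by linarith [hM x, hM y])

lemma meanSqIncrement_le {u : ℝ → ℝ} {T M : ℝ} (hu : Function.Periodic u T)
    (hT : 0 < T) (hm : Measurable u) (hM : ∀ x, |u x| ≤ M) (hM1 : 1 ≤ M)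
    (hinc : ∀ x y : ℝ, x ≤ y → u y - u x ≤ y - x) (h : ℝ) :
    meanSqIncrement T u h ≤ 4 * M ^ 2 * min |h| 1 := by
  have hd := abs_sub_le_two_mul hM
  have hsq : ∀ x, (u (x + h) - u x) ^ 2 ≤ 4 * M ^ 2 := fun x => by
    have := sq_le_sq' (abs_le.1 (hd (x + h) x)).1 (abs_le.1 (hd (x + h) x)).2
    linarith
  have hsqi : IntegrableOn (fun x => (u (x + h) - u x) ^ 2) (Ioo 0 T) :=
    integrableOn_Ioo_of_bounded (by fun_prop) fun x => by
      rw [abs_of_nonneg (sq_nonneg _)]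
      exact hsq x
  have hfi : IntegrableOn (fun x => u (x + h) - u x) (Ioo 0 T) :=
    integrableOn_Ioo_of_bounded (by fun_prop) fun x => hd _ _
  have hzero := hu.setIntegral_increment_eq_zero hT hm hM h
  have key : ∀ A B : ℝ, (∀ x, (u (x + h) - u x) ^ 2 ≤ A + B * (u (x + h) - u x)) →
      meanSqIncrement T u h ≤ A := by
    intro A B hAB
    have := integral_mono hsqi ((integrable_const A).add (hfi.const_mul B)) hAB
    rw [Pi.add_def, integral_add (integrable_const A) (hfi.const_mul B), integral_const_mul, hzero]
      at this
    simp only [integral_const, MeasurableSet.univ, measureReal_restrict_apply, univ_inter,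
      Real.volume_real_Ioo_of_le hT.le, smul_eq_mul, sub_zero, mul_zero, add_zero] at this
    rw [meanSqIncrement, one_div, inv_mul_le_iff₀ hT]
    exact this
  rw [mul_min_of_nonneg _ _ (by positivity)]
  refine le_min ?_ ?_
  · refine (?_ : _ ≤ 4 * M * |h|).trans (by gcongr; nlinarith)
    rcases le_total 0 h with hh | hh
    · refine key _ (-(2 * M)) fun x => ?_
      rw [abs_of_nonneg hh]
      have h1 := hinc x (x + h) (by linarith)
      have h2 := abs_le.1 (hd (x + h) x)
      nlinarith
    · refine key _ (2 * M) fun x => ?_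
      rw [abs_of_nonpos hh]
      have h1 := hinc (x + h) x (by linarith)
      have h2 := abs_le.1 (hd (x + h) x)
      nlinarith
  · refine key _ 0 fun x => ?_
    linarith [hsq x]

/-- The mean square increment of a sawtooth of slope `1` and period `p` with vertical jumps. -/
def sawtoothIncrement (p h : ℝ) : ℝ :=
  p ^ 2 * (Int.fract (h / p) * (1 - Int.fract (h / p)))

lemma integral_increment_mul {u : ℝ → ℝ} {T M : ℝ} (hu : Function.Periodic u T)
    (hT : 0 < T) (hm : Measurable u) (hM : ∀ x, |u x| ≤ M) (h p : ℝ) :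
    ∫ x in Ioo 0 T, (u (x + h) - u x - p * Int.fract (h / p)) *
        (u (x + h) - u x - p * Int.fract (h / p) + p) =
      T * (meanSqIncrement T u h - sawtoothIncrement p h) := by
  have hd := abs_sub_le_two_mul hM
  have hsqi : IntegrableOn (fun x => (u (x + h) - u x) ^ 2) (Ioo 0 T) :=
    integrableOn_Ioo_of_bounded (C := (2 * M) ^ 2) (by fun_prop) fun x => by
      rw [abs_of_nonneg (sq_nonneg _)]
      exact sq_le_sq' (abs_le.1 (hd (x + h) x)).1 (abs_le.1 (hd (x + h) x)).2
  have hfi : IntegrableOn (fun x => u (x + h) - u x) (Ioo 0 T) :=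
    integrableOn_Ioo_of_bounded (by fun_prop) fun x => hd _ _
  have hzero := hu.setIntegral_increment_eq_zero hT hm hM h
  have heq : ∀ x, (u (x + h) - u x - p * Int.fract (h / p)) *
        (u (x + h) - u x - p * Int.fract (h / p) + p) =
      (u (x + h) - u x) ^ 2 + (p - 2 * (p * Int.fract (h / p))) * (u (x + h) - u x) +
        (-sawtoothIncrement p h) := fun x => by
    rw [sawtoothIncrement]
    ring
  simp_rw [heq]
  have hsum : IntegrableOn (fun x => (u (x + h) - u x) ^ 2 +
      (p - 2 * (p * Int.fract (h / p))) * (u (x + h) - u x)) (Ioo 0 T) :=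
    hsqi.add (hfi.const_mul _)
  rw [integral_add hsum (integrable_const _),
    integral_add hsqi (hfi.const_mul _), integral_const_mul, hzero, meanSqIncrement]
  simp only [integral_const, MeasurableSet.univ, measureReal_restrict_apply, univ_inter,
    Real.volume_real_Ioo_of_le hT.le, smul_eq_mul, sub_zero, mul_zero, add_zero]
  field_simp
  ring

lemma volume_real_bad_le {N : Set ℝ} {T κ : ℝ}
    (hN : ∀ x : ℝ, volume.real (N ∩ Ioc x (x + T)) = κ) (h : ℝ) :
    volume.real ((N ∪ (fun x => x + h) ⁻¹' N) ∩ Ioo 0 T) ≤ 2 * κ := by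
  have hfin : ∀ x, volume (N ∩ Ioc x (x + T)) ≠ ⊤ := fun x =>
    ((measure_mono inter_subset_right).trans_lt (by simp)).ne
  have h2 : volume ((fun x => x + h) ⁻¹' (N ∩ Ioc h (h + T))) = volume (N ∩ Ioc h (h + T)) :=
    measure_preimage_add_right volume h _
  have hsub : (N ∪ (fun x => x + h) ⁻¹' N) ∩ Ioo 0 T ⊆
      (N ∩ Ioc 0 (0 + T)) ∪ (fun x => x + h) ⁻¹' (N ∩ Ioc h (h + T)) := by
    rintro x ⟨hx | hx, h0, h1⟩
    · exact Or.inl ⟨hx, h0, by linarith⟩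
    · exact Or.inr ⟨hx, by simpa using h0, by simp only; linarith⟩
  calc _ ≤ volume.real ((N ∩ Ioc 0 (0 + T)) ∪ (fun x => x + h) ⁻¹' (N ∩ Ioc h (h + T))) :=
        measureReal_mono hsub (measure_union_ne_top (hfin 0) (h2 ▸ hfin h))
    _ ≤ volume.real (N ∩ Ioc 0 (0 + T)) +
        volume.real ((fun x => x + h) ⁻¹' (N ∩ Ioc h (h + T))) := measureReal_union_le _ _
    _ = 2 * κ := by
        rw [hN 0, measureReal_def volume (_ ⁻¹' _), h2, ← measureReal_def, hN h]
        ring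

/-- Away from a set of density at most `2 / (Λ + 1)`, the increment at distance `h` takes values
in the coset `h + ℤ p`, where `p = (Λ + 1) * δ`. -/
lemma Admissible.exists_increment_mem_coset {T Λ δ : ℝ} {u : ℝ → ℝ} (hu : Admissible T Λ δ u)
    (hT : 0 < T) (hΛ : 0 < Λ) (hδ : 0 < δ) (h : ℝ) :
    ∃ B : Set ℝ, MeasurableSet B ∧
      volume.real (B ∩ Ioo 0 T) * (4 * ((Λ + 1) * δ) ^ 2) ≤ T * (8 * ((Λ + 1) * δ) * δ) ∧
      ∀ x ∉ B, ∃ j : ℤ, u (x + h) - u x -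
        (Λ + 1) * δ * Int.fract (h / ((Λ + 1) * δ)) = j * ((Λ + 1) * δ) := by
  obtain ⟨-, N, hNm, hN, hκ⟩ := hu.increment_structure hT hΛ hδ
  refine ⟨N ∪ (fun x => x + h) ⁻¹' N, hNm.union ((measurable_add_const h) hNm), ?_,
    fun x hx => ?_⟩
  · have hvol := volume_real_bad_le hκ h
    calc _ ≤ 2 * (T / (Λ + 1)) * (4 * ((Λ + 1) * δ) ^ 2) := by gcongr
      _ = T * (8 * ((Λ + 1) * δ) * δ) := by
        field_simp
        ring
  · simp only [mem_union, not_or] at hx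
    obtain ⟨m, hm⟩ := hN x hx.1 (x + h) hx.2
    refine ⟨⌊h / ((Λ + 1) * δ)⌋ + m, ?_⟩
    rw [hm, Int.fract]
    push_cast
    field_simp
    ring

lemma Continuous.integrableOn_increment_mul {u : ℝ → ℝ} (hu : Continuous u) (T h a p : ℝ) :
    IntegrableOn (fun x => (u (x + h) - u x - a) * (u (x + h) - u x - a + p)) (Ioo 0 T) :=
  (Continuous.integrableOn_Icc (by fun_prop)).mono_set Ioo_subset_Icc_self

/-- The parabola with zeros at the two consecutive points `p * fract (h / p) - p` and
`p * fract (h / p)` of the coset `h + ℤ p` is nonnegative on that coset. -/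
lemma Admissible.sawtoothIncrement_le {T Λ δ : ℝ} {u : ℝ → ℝ} (hu : Admissible T Λ δ u)
    (hT : 0 < T) (hΛ : 0 < Λ) (hδ : 0 < δ) {M : ℝ} (hM : ∀ x, |u x| ≤ M) (h : ℝ) :
    sawtoothIncrement ((Λ + 1) * δ) h - 8 * ((Λ + 1) * δ) * δ ≤ meanSqIncrement T u h := by
  obtain ⟨B, hBm, hvol, hB⟩ := hu.exists_increment_mem_coset hT hΛ hδ h
  set p := (Λ + 1) * δ with hp
  have hle : ∀ x, B.indicator (fun _ => -(4 * p ^ 2)) x ≤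
      (u (x + h) - u x - p * Int.fract (h / p)) *
        (u (x + h) - u x - p * Int.fract (h / p) + p) := by
    intro x
    by_cases hx : x ∈ B
    · rw [indicator_of_mem hx]
      nlinarith [sq_nonneg (2 * (u (x + h) - u x - p * Int.fract (h / p)) + p), sq_nonneg p]
    · rw [indicator_of_notMem hx]
      obtain ⟨j, hj⟩ := hB x hx
      rw [hj]
      have hj0 : 0 ≤ j * (j + 1) := by
        rcases le_or_gt 0 j with h0 | h0
        · positivity
        · exact mul_nonneg_of_nonpos_of_nonpos h0.le (by lia)
      have hj1 : (0 : ℝ) ≤ (j : ℝ) * ((j : ℝ) + 1) := by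
        exact_mod_cast hj0
      nlinarith [mul_nonneg hj1 (sq_nonneg p)]
  have hintegral := integral_mono (μ := volume.restrict (Ioo 0 T))
    ((integrable_const (-(4 * p ^ 2))).indicator hBm)
    (hu.cont.integrableOn_increment_mul T h _ p) hle
  rw [integral_increment_mul hu.per hT hu.cont.measurable hM, integral_indicator_const _ hBm,
    measureReal_restrict_apply hBm, smul_eq_mul] at hintegral
  have h1 : T * -(8 * p * δ) ≤ T * (meanSqIncrement T u h - sawtoothIncrement p h) := by
    linarith
  have := le_of_mul_le_mul_left h1 hT
  linarith

/-- If the oscillation of `u` is smaller than the jump `(Λ + 1) * δ`, then the increment takes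
only the two values at which the parabola vanishes. -/
lemma Admissible.meanSqIncrement_le_sawtoothIncrement {T Λ δ : ℝ} {u : ℝ → ℝ}
    (hu : Admissible T Λ δ u) (hT : 0 < T) (hΛ : 0 < Λ) (hδ : 0 < δ) {M : ℝ}
    (hM : ∀ x, |u x| ≤ M) (hosc : ∀ x y, u x - u y < (Λ + 1) * δ) (h : ℝ) :
    meanSqIncrement T u h ≤ sawtoothIncrement ((Λ + 1) * δ) h + 8 * ((Λ + 1) * δ) * δ := by
  obtain ⟨B, hBm, hvol, hB⟩ := hu.exists_increment_mem_coset hT hΛ hδ h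
  set p := (Λ + 1) * δ with hp
  have hp0 : 0 < p := by positivity
  have ha0 : 0 ≤ p * Int.fract (h / p) := mul_nonneg hp0.le (Int.fract_nonneg _)
  have ha1 : p * Int.fract (h / p) < p := by
    have := mul_lt_mul_of_pos_left (Int.fract_lt_one (h / p)) hp0
    linarith
  have hle : ∀ x, (u (x + h) - u x - p * Int.fract (h / p)) *
        (u (x + h) - u x - p * Int.fract (h / p) + p) ≤ B.indicator (fun _ => 4 * p ^ 2) x := by
    intro x
    have hf1 := hosc (x + h) x
    have hf2 := hosc x (x + h)
    by_cases hx : x ∈ B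
    · rw [indicator_of_mem hx]
      nlinarith
    · rw [indicator_of_notMem hx]
      obtain ⟨j, hj⟩ := hB x hx
      have hj1 : j < 1 := by
        have : (j : ℝ) < 1 := by nlinarith
        exact_mod_cast this
      have hj2 : -2 < j := by
        have : (-2 : ℝ) < j := by nlinarith
        exact_mod_cast this
      rw [hj]
      obtain rfl | rfl : j = 0 ∨ j = -1 := by lia
      all_goals simp
  have hintegral := integral_mono (μ := volume.restrict (Ioo 0 T))
    (hu.cont.integrableOn_increment_mul T h _ p)
    ((integrable_const (4 * p ^ 2)).indicator hBm) hle
  rw [integral_increment_mul hu.per hT hu.cont.measurable hM, integral_indicator_const _ hBm,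
    measureReal_restrict_apply hBm, smul_eq_mul] at hintegral
  have := le_of_mul_le_mul_left (hintegral.trans hvol) hT
  linarith

lemma meanSqIncrement_fract (h : ℝ) :
    meanSqIncrement 1 Int.fract h = sawtoothIncrement 1 h := by
  have hper : Function.Periodic (Int.fract : ℝ → ℝ) 1 := fun x => Int.fract_add_one x
  have hM : ∀ x : ℝ, |Int.fract x| ≤ 1 := fun x => by
    rw [Int.abs_fract]
    exact (Int.fract_lt_one x).le
  have hintegral := integral_increment_mul hper one_pos measurable_fract hM h 1
  have hzero : ∀ x : ℝ, (Int.fract (x + h) - Int.fract x - 1 * Int.fract (h / 1)) *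
      (Int.fract (x + h) - Int.fract x - 1 * Int.fract (h / 1) + 1) = 0 := by
    intro x
    rw [one_mul, div_one]
    obtain ⟨k, hk⟩ := Int.fract_add x h
    have h1 := Int.fract_nonneg (x + h)
    have h2 := Int.fract_lt_one (x + h)
    have h3 := Int.fract_nonneg x
    have h4 := Int.fract_lt_one x
    have h5 := Int.fract_nonneg h
    have h6 := Int.fract_lt_one h
    have hk1 : k < 1 := by
      have : (k : ℝ) < 1 := by linarith
      exact_mod_cast this
    have hk2 : -2 < k := by
      have : (-2 : ℝ) < k := by linarith
      exact_mod_cast this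
    have hk3 : Int.fract (x + h) - Int.fract x - Int.fract h = k := by linarith
    rw [hk3]
    obtain rfl | rfl : k = 0 ∨ k = -1 := by lia
    all_goals norm_num
  simp_rw [hzero] at hintegral
  simp only [integral_zero, one_mul] at hintegral
  linarith
lemma integrable_min_abs_one_div_rpow {s : ℝ} (hs : 0 < s) (hs2 : s < 1 / 2) :
    Integrable fun h : ℝ => min |h| 1 / |h| ^ (1 + 2 * s) := by
  have hpos : IntegrableOn (fun h : ℝ => min |h| 1 / |h| ^ (1 + 2 * s)) (Ioi 0) := by
    rw [← Ioc_union_Ioi_eq_Ioi (zero_le_one' ℝ)]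
    refine IntegrableOn.union ?_ ?_
    · have h1 : IntegrableOn (fun h : ℝ => h ^ (-(2 * s))) (Ioc 0 1) :=
        (intervalIntegral.intervalIntegrable_rpow' (by linarith)).1
      refine h1.congr_fun (fun h hh => ?_) measurableSet_Ioc
      simp only
      rw [abs_of_pos hh.1, min_eq_left hh.2, Real.rpow_add hh.1, Real.rpow_one,
        Real.rpow_neg hh.1.le]
      have := (Real.rpow_pos_of_pos hh.1 (2 * s)).ne'
      have := hh.1.ne'
      field_simp
    · refine (integrableOn_Ioi_rpow_of_lt (a := -(1 + 2 * s)) (by linarith) one_pos).congr_fun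
        (fun h hh => ?_) measurableSet_Ioi
      have h0 : (0 : ℝ) < h := one_pos.trans hh
      simp only
      rw [abs_of_pos h0, min_eq_right (le_of_lt hh), Real.rpow_neg h0.le, one_div]
  have hneg : IntegrableOn (fun h : ℝ => min |h| 1 / |h| ^ (1 + 2 * s)) (Iio 0) := by
    have := IntegrableOn.comp_neg_Iio (c := (0 : ℝ)) (by simpa using hpos)
    simpa using this
  rw [← integrableOn_univ, ← Iic_union_Ioi (a := (0 : ℝ))]
  exact ((integrableOn_Iic_iff_integrableOn_Iio (by simp)).2 hneg).union hpos

/-- The energy density is the mean square increment integrated against the kernel. -/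
lemma Fs_eq_integral_meanSqIncrement {s T M C : ℝ} {u : ℝ → ℝ} (hs : 0 < s) (hs2 : s < 1 / 2)
    (hT : 0 < T) (hm : Measurable u) (hM : ∀ x, |u x| ≤ M)
    (hC : ∀ h, meanSqIncrement T u h ≤ C * min |h| 1) :
    Integrable (fun h => meanSqIncrement T u h / |h| ^ (1 + 2 * s)) ∧
      Fs s T u = (1 / 2) * ∫ h, meanSqIncrement T u h / |h| ^ (1 + 2 * s) := by
  set f : ℝ → ℝ → ℝ := fun x h => (u (x + h) - u x) ^ 2 / |h| ^ (1 + 2 * s) with hf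
  have hfm : Measurable (Function.uncurry f) := by
    simp only [hf, Function.uncurry_def]
    fun_prop
  have hinner : ∀ h, ∫ x in Ioo 0 T, f x h =
      T * (meanSqIncrement T u h / |h| ^ (1 + 2 * s)) := fun h => by
    rw [integral_div, meanSqIncrement]
    field_simp
  have hmi : Integrable (fun h => meanSqIncrement T u h / |h| ^ (1 + 2 * s)) := by
    refine ((integrable_min_abs_one_div_rpow hs hs2).const_mul C).mono' ?_
      (Eventually.of_forall fun h => ?_)
    · have h1 : StronglyMeasurable fun h => ∫ x in Ioo 0 T, f x h :=
        hfm.stronglyMeasurable.integral_prod_left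
      have h2 : StronglyMeasurable fun h => T⁻¹ * ∫ x in Ioo 0 T, f x h := h1.const_mul _
      refine h2.aestronglyMeasurable.congr (Eventually.of_forall fun h => ?_)
      simp only
      rw [hinner]
      field_simp
    · have hk : 0 ≤ |h| ^ (1 + 2 * s) := by positivity
      rw [Real.norm_of_nonneg (div_nonneg (meanSqIncrement_nonneg hT u h) hk), ← mul_div_assoc]
      exact div_le_div_of_nonneg_right (hC h) hk
  refine ⟨hmi, ?_⟩
  have hintegral : Integrable (Function.uncurry f) ((volume.restrict (Ioo 0 T)).prod volume) := by
    rw [integrable_prod_iff' hfm.aestronglyMeasurable]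
    constructor
    · refine Eventually.of_forall fun h => ?_
      change Integrable (fun x => (u (x + h) - u x) ^ 2 / |h| ^ (1 + 2 * s)) _
      refine Integrable.div_const (integrableOn_Ioo_of_bounded (C := (2 * M) ^ 2) ?_ fun x => ?_) _
      · fun_prop
      · have := abs_le.1 (abs_sub_le_two_mul hM (x + h) x)
        rw [abs_of_nonneg (sq_nonneg _)]
        exact sq_le_sq' this.1 this.2
    · have heq : ∀ h, ∫ x in Ioo 0 T, ‖Function.uncurry f (x, h)‖ =
          T * (meanSqIncrement T u h / |h| ^ (1 + 2 * s)) := fun h => by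
        rw [← hinner]
        refine integral_congr_ae (Eventually.of_forall fun x => ?_)
        simp only [Function.uncurry_apply_pair]
        exact Real.norm_of_nonneg (by positivity)
      simp_rw [heq]
      exact hmi.const_mul T
  have htrans : ∀ x, ∫ y : ℝ, (u x - u y) ^ 2 / |x - y| ^ (1 + 2 * s) = ∫ h, f x h := fun x => by
    rw [← integral_add_left_eq_self _ x]
    refine integral_congr_ae (Eventually.of_forall fun h => ?_)
    simp only [hf]
    rw [sub_add_cancel_left, abs_neg, sub_sq_comm]
  rw [Fs]
  simp_rw [htrans]
  rw [integral_integral_swap hintegral]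
  simp_rw [hinner]
  rw [integral_const_mul]
  field_simp

section ubar

variable {Λ δ : ℝ}

lemma ubar_eq_max (hΛ : 0 < Λ) (x : ℝ) : ubar Λ δ x =
    max (-Λ * ((Λ + 1) * δ * Int.fract ((x + δ) / ((Λ + 1) * δ)) - δ))
      ((Λ + 1) * δ * Int.fract ((x + δ) / ((Λ + 1) * δ)) - δ) := by
  simp only [ubar]
  split_ifs with h
  · exact (max_eq_left (by nlinarith)).symm
  · exact (max_eq_right (by nlinarith)).symm

lemma ubar_of_mem_Ico (hΛ : 0 < Λ) (hδ : 0 < δ) {k : ℤ} {x : ℝ}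
    (hx : x - k * ((Λ + 1) * δ) ∈ Ico (-δ) (Λ * δ)) :
    ubar Λ δ x = max (-Λ * (x - k * ((Λ + 1) * δ))) (x - k * ((Λ + 1) * δ)) := by
  have hp : 0 < (Λ + 1) * δ := by positivity
  have hfl : ⌊(x + δ) / ((Λ + 1) * δ)⌋ = k := by
    rw [Int.floor_eq_iff, le_div_iff₀ hp, div_lt_iff₀ hp]
    constructor <;> nlinarith [hx.1, hx.2]
  rw [ubar_eq_max hΛ, Int.fract, hfl]
  have : (Λ + 1) * δ * ((x + δ) / ((Λ + 1) * δ) - k) - δ = x - k * ((Λ + 1) * δ) := by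
    field_simp
    ring
  rw [this]

lemma exists_int_sub_mem_Ico (hΛ : 0 < Λ) (hδ : 0 < δ) (x : ℝ) :
    ∃ k : ℤ, x - k * ((Λ + 1) * δ) ∈ Ico (-δ) (Λ * δ) := by
  have hp : 0 < (Λ + 1) * δ := by positivity
  refine ⟨⌊(x + δ) / ((Λ + 1) * δ)⌋, ?_⟩
  have h1 := Int.floor_le ((x + δ) / ((Λ + 1) * δ))
  have h2 := Int.lt_floor_add_one ((x + δ) / ((Λ + 1) * δ))
  rw [le_div_iff₀ hp] at h1
  rw [div_lt_iff₀ hp] at h2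
  constructor <;> nlinarith

lemma ubar_mem_Icc (hΛ : 0 < Λ) (hδ : 0 < δ) (x : ℝ) : ubar Λ δ x ∈ Icc 0 (Λ * δ) := by
  obtain ⟨k, hk⟩ := exists_int_sub_mem_Ico hΛ hδ x
  rw [ubar_of_mem_Ico hΛ hδ hk]
  obtain ⟨h1, h2⟩ := hk
  refine ⟨?_, max_le (by nlinarith) h2.le⟩
  rcases le_total 0 (x - k * ((Λ + 1) * δ)) with h | h
  · exact le_max_of_le_right h
  · exact le_max_of_le_left (by nlinarith)

lemma continuous_ubar (hΛ : 0 < Λ) (hδ : 0 < δ) : Continuous (ubar Λ δ) := by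
  have h : Continuous ((fun t : ℝ => max (-Λ * ((Λ + 1) * δ * t - δ)) ((Λ + 1) * δ * t - δ)) ∘
      Int.fract) := by
    refine ContinuousOn.comp_fract'' (by fun_prop) ?_
    rw [max_eq_left (by nlinarith),
      max_eq_right (by nlinarith [mul_pos hΛ hδ, mul_pos hΛ (mul_pos hΛ hδ)])]
    ring
  have h2 : ubar Λ δ = ((fun t : ℝ => max (-Λ * ((Λ + 1) * δ * t - δ)) ((Λ + 1) * δ * t - δ)) ∘
      Int.fract) ∘ fun x => (x + δ) / ((Λ + 1) * δ) := by
    ext x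
    exact ubar_eq_max hΛ x
  rw [h2]
  exact h.comp (by fun_prop)

lemma ubar_periodic (hΛ : 0 < Λ) (hδ : 0 < δ) :
    Function.Periodic (ubar Λ δ) ((Λ + 1) * δ) := by
  intro x
  have hp : (Λ + 1) * δ ≠ 0 := by positivity
  rw [ubar_eq_max hΛ, ubar_eq_max hΛ, add_right_comm, add_div, div_self hp, Int.fract_add_one]

lemma ubar_eq_of_lt (hΛ : 0 < Λ) (hδ : 0 < δ) {k : ℤ} {x : ℝ}
    (h0 : -δ < x - k * ((Λ + 1) * δ)) (h1 : x - k * ((Λ + 1) * δ) < 0) :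
    ∃ ε > 0, ∀ y : ℝ, |y - x| < ε → ubar Λ δ y = -Λ * y + Λ * (k * ((Λ + 1) * δ)) := by
  refine ⟨min (x - k * ((Λ + 1) * δ) + δ) (-(x - k * ((Λ + 1) * δ))),
    lt_min (by linarith) (by linarith), fun y hy => ?_⟩
  obtain ⟨hy1, hy2⟩ := lt_min_iff.1 hy
  rw [abs_lt] at hy1 hy2
  rw [ubar_of_mem_Ico hΛ hδ (k := k) ⟨by linarith, by nlinarith⟩, max_eq_left (by nlinarith)]
  ring

lemma ubar_eq_of_gt (hΛ : 0 < Λ) (hδ : 0 < δ) {k : ℤ} {x : ℝ}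
    (h0 : 0 < x - k * ((Λ + 1) * δ)) (h1 : x - k * ((Λ + 1) * δ) < Λ * δ) :
    ∃ ε > 0, ∀ y : ℝ, |y - x| < ε → ubar Λ δ y = 1 * y + -(k * ((Λ + 1) * δ)) := by
  refine ⟨min (x - k * ((Λ + 1) * δ)) (Λ * δ - (x - k * ((Λ + 1) * δ))),
    lt_min (by linarith) (by linarith), fun y hy => ?_⟩
  obtain ⟨hy1, hy2⟩ := lt_min_iff.1 hy
  rw [abs_lt] at hy1 hy2
  rw [ubar_of_mem_Ico hΛ hδ (k := k) ⟨by linarith, by linarith⟩, max_eq_right (by nlinarith)]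
  ring

lemma ubar_corner_iff (hΛ : 0 < Λ) (hδ : 0 < δ) {k : ℤ} {x : ℝ}
    (hx : x - k * ((Λ + 1) * δ) ∈ Ico (-δ) (Λ * δ)) :
    (ubar Λ δ x = 0 ∨ ubar Λ δ x = Λ * δ) ↔
      (x - k * ((Λ + 1) * δ) = 0 ∨ x - k * ((Λ + 1) * δ) = -δ) := by
  rw [ubar_of_mem_Ico hΛ hδ hx]
  obtain ⟨h1, h2⟩ := hx
  generalize x - k * ((Λ + 1) * δ) = y at *
  have hΛδ := mul_pos hΛ hδ
  rcases le_or_gt 0 y with h | h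
  · rw [max_eq_right (by nlinarith)]
    constructor
    · rintro (h3 | h3)
      · exact Or.inl h3
      · linarith
    · rintro (h3 | h3)
      · exact Or.inl h3
      · linarith
  · rw [max_eq_left (by nlinarith)]
    constructor
    · rintro (h3 | h3)
      · nlinarith
      · right
        exact mul_left_cancel₀ hΛ.ne' (by linarith)
    · rintro (h3 | h3)
      · linarith
      · right
        rw [h3]
        ring

lemma ubar_corner_isolated (hΛ : 0 < Λ) (hδ : 0 < δ) :
    ∀ x ∈ {x | ubar Λ δ x = 0 ∨ ubar Λ δ x = Λ * δ}, ∃ ε > 0,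
      {x | ubar Λ δ x = 0 ∨ ubar Λ δ x = Λ * δ} ∩ Ioo (x - ε) (x + ε) ⊆ {x} := by
  intro x hx
  have hΛδ := mul_pos hΛ hδ
  obtain ⟨k, hk⟩ := exists_int_sub_mem_Ico hΛ hδ x
  refine ⟨min δ (Λ * δ), lt_min hδ hΛδ, ?_⟩
  rintro y ⟨hy, hy1, hy2⟩
  have hm1 := min_le_left δ (Λ * δ)
  have hm2 := min_le_right δ (Λ * δ)
  rw [mem_singleton_iff]
  rcases (ubar_corner_iff hΛ hδ hk).1 hx with h | h
  · rcases (ubar_corner_iff hΛ hδ (k := k) (x := y) ⟨by linarith, by linarith⟩).1 hy with h2 | h2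
      <;> linarith
  · rcases le_or_gt x y with hxy | hxy
    · rcases (ubar_corner_iff hΛ hδ (k := k) (x := y) ⟨by linarith, by linarith⟩).1 hy with h2 | h2
        <;> linarith
    · have hk' : y - ((k - 1 : ℤ) : ℝ) * ((Λ + 1) * δ) =
          y - k * ((Λ + 1) * δ) + (Λ * δ + δ) := by
        push_cast
        ring
      rcases (ubar_corner_iff hΛ hδ (k := k - 1) (x := y)
        ⟨by rw [hk']; linarith, by rw [hk']; linarith⟩).1 hy with h2 | h2 <;>
      · rw [hk'] at h2
        linarith

lemma ubar_admissible (hΛ : 0 < Λ) (hδ : 0 < δ) (L : ℕ) :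
    Admissible (L * ((Λ + 1) * δ)) Λ δ (ubar Λ δ) := by
  have hΛδ := mul_pos hΛ hδ
  have hcont := continuous_ubar hΛ hδ
  have hsmooth : ∀ x ∉ {x | ubar Λ δ x = 0 ∨ ubar Λ δ x = Λ * δ}, ∃ k : ℤ,
      (-δ < x - k * ((Λ + 1) * δ) ∧ x - k * ((Λ + 1) * δ) < 0) ∨
      (0 < x - k * ((Λ + 1) * δ) ∧ x - k * ((Λ + 1) * δ) < Λ * δ) := by
    intro x hx
    obtain ⟨k, hk⟩ := exists_int_sub_mem_Ico hΛ hδ x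
    rw [mem_ofPred_eq, ubar_corner_iff hΛ hδ hk, not_or] at hx
    refine ⟨k, ?_⟩
    rcases lt_or_gt_of_ne hx.1 with h | h
    · exact Or.inl ⟨lt_of_le_of_ne hk.1 (Ne.symm hx.2), h⟩
    · exact Or.inr ⟨h, hk.2⟩
  refine ⟨hcont, (ubar_periodic hΛ hδ).nat_mul L, ?_, ?_, ?_⟩
  · refine ⟨{x | ubar Λ δ x = 0 ∨ ubar Λ δ x = Λ * δ}, ?_, ubar_corner_isolated hΛ hδ,
      fun x hx => ?_⟩
    · exact (isClosed_eq hcont continuous_const).union (isClosed_eq hcont continuous_const)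
    · obtain ⟨k, hk | hk⟩ := hsmooth x hx
      · obtain ⟨ε, hε, h⟩ := ubar_eq_of_lt hΛ hδ hk.1 hk.2
        exact ⟨ε, hε, _, _, h⟩
      · obtain ⟨ε, hε, h⟩ := ubar_eq_of_gt hΛ hδ hk.1 hk.2
        exact ⟨ε, hε, _, _, h⟩
  · filter_upwards [(countable_of_isolated (ubar_corner_isolated hΛ hδ)).ae_notMem volume]
      with x hx
    obtain ⟨k, hk | hk⟩ := hsmooth x hx
    · obtain ⟨ε, hε, h⟩ := ubar_eq_of_lt hΛ hδ hk.1 hk.2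
      exact Or.inr (hasDerivAt_of_eq_affine hε h)
    · obtain ⟨ε, hε, h⟩ := ubar_eq_of_gt hΛ hδ hk.1 hk.2
      exact Or.inl (hasDerivAt_of_eq_affine hε h)
  · let e : ℕ ≃ ℤ := (Denumerable.eqv ℤ).symm
    refine ⟨fun n => e n * ((Λ + 1) * δ) - δ, fun n x hx => ?_, fun x hx => ?_,
      fun i j hij => ?_⟩
    · obtain ⟨ε, hε, h⟩ := ubar_eq_of_lt hΛ hδ (k := e n) (x := x) (by linarith [hx.1])
        (by linarith [hx.2])
      exact hasDerivAt_of_eq_affine hε h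
    · obtain ⟨k, hk⟩ := exists_int_sub_mem_Ico hΛ hδ x
      refine mem_iUnion.2 ⟨e.symm k, ?_⟩
      simp only [e.apply_symm_apply]
      refine ⟨by linarith [hk.1], ?_⟩
      by_contra! hlt
      obtain ⟨ε, hε, h⟩ := ubar_eq_of_gt hΛ hδ (k := k) (x := x) (by linarith) hk.2
      have := (hasDerivAt_of_eq_affine hε h).unique hx
      linarith
    · have hne : e i ≠ e j := e.injective.ne hij
      have hp : 0 < (Λ + 1) * δ := by positivity
      rintro x ⟨⟨h1, h2⟩, h3, h4⟩
      exfalso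
      rcases lt_or_gt_of_ne hne with h | h
      · have : (e i : ℝ) + 1 ≤ e j := by exact_mod_cast h
        nlinarith
      · have : (e j : ℝ) + 1 ≤ e i := by exact_mod_cast h
        nlinarith

end ubar

lemma continuous_fract_mul_one_sub_fract :
    Continuous fun t : ℝ => Int.fract t * (1 - Int.fract t) :=
  ContinuousOn.comp_fract'' (f := fun t : ℝ => t * (1 - t)) (by fun_prop) (by norm_num)

lemma tendsto_sawtoothIncrement {p : ℕ → ℝ} (hp : Tendsto p atTop (𝓝 1)) (h : ℝ) :
    Tendsto (fun n => sawtoothIncrement (p n) h) atTop (𝓝 (sawtoothIncrement 1 h)) :=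
  (hp.pow 2).mul ((continuous_fract_mul_one_sub_fract.tendsto _).comp
    (tendsto_const_nhds.div hp one_ne_zero))

lemma measurable_sawtoothIncrement (p : ℝ) : Measurable (sawtoothIncrement p) := by
  unfold sawtoothIncrement
  exact (continuous_fract_mul_one_sub_fract.measurable.comp (measurable_id.div_const p)).const_mul _

lemma Function.Periodic.exists_forall_abs_le {u : ℝ → ℝ} {T : ℝ} (hu : Function.Periodic u T)
    (hT : 0 < T) (hc : Continuous u) : ∃ M, 1 ≤ M ∧ ∀ x, |u x| ≤ M := by
  obtain ⟨C, hC⟩ := (isCompact_Icc (a := (0 : ℝ)) (b := T)).exists_bound_of_continuousOn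
    hc.continuousOn
  refine ⟨max 1 C, le_max_left _ _, fun x => le_max_of_le_right ?_⟩
  obtain ⟨y, hy, hxy⟩ := hu.exists_mem_Ico₀ hT x
  rw [hxy]
  exact hC y ⟨hy.1, hy.2.le⟩

/-- asymptotics of the minimal energy for `0 < s < 1/2`. -/
theorem statement3 (s : ℝ) (hs : 0 < s) (hs2 : s < 1 / 2)
    (δ : ℕ → ℝ) (hδpos : ∀ n, 0 < δ n) (hδ0 : Tendsto δ atTop (𝓝 0))
    (L : ℕ → ℕ) (hL : ∀ n, 0 < L n)
    (T : ℕ → ℝ) (hT : ∀ n, T n = (L n : ℝ) * ((1 / δ n + 1) * δ n))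
    (u : ℕ → ℝ → ℝ) (hadm : ∀ n, Admissible (T n) (1 / δ n) (δ n) (u n))
    (hmin : ∀ n, ∀ v : ℝ → ℝ, Admissible (T n) (1 / δ n) (δ n) v →
      Fs s (T n) (u n) ≤ Fs s (T n) v) :
    Tendsto (fun n => Fs s (T n) (u n)) atTop
      (𝓝 ((1 / 2) * ∫ x in Set.Ioo (0 : ℝ) 1, ∫ y : ℝ,
        (Int.fract x - Int.fract y) ^ 2 / |x - y| ^ (1 + 2 * s))) := by
  have hΛ : ∀ n, 0 < 1 / δ n := fun n => one_div_pos.2 (hδpos n)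
  have hp : ∀ n, (1 / δ n + 1) * δ n = 1 + δ n := fun n => by
    have := (hδpos n).ne'
    field_simp
  have hT0 : ∀ n, 0 < T n := fun n => by
    rw [hT, hp]
    have := hδpos n
    have := hL n
    positivity
  have hp1 : Tendsto (fun n => 1 + δ n) atTop (𝓝 1) := by
    simpa using hδ0.const_add 1
  have herr : Tendsto (fun n => 8 * (1 + δ n) * δ n) atTop (𝓝 0) := by
    simpa using (hp1.const_mul 8).mul hδ0
  have hvadm : ∀ n, Admissible (T n) (1 / δ n) (δ n) (ubar (1 / δ n) (δ n)) := fun n => by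
    rw [hT]
    exact ubar_admissible (hΛ n) (hδpos n) (L n)
  have hv01 : ∀ n x, ubar (1 / δ n) (δ n) x ∈ Icc 0 1 := fun n x => by
    have := ubar_mem_Icc (hΛ n) (hδpos n) x
    rwa [one_div_mul_cancel (hδpos n).ne'] at this
  have hvM : ∀ n x, |ubar (1 / δ n) (δ n) x| ≤ 1 := fun n x =>
    abs_le.2 ⟨by linarith [(hv01 n x).1], (hv01 n x).2⟩
  set v := fun n => ubar (1 / δ n) (δ n) with hv
  set l : ℕ → ℝ → ℝ := fun n h =>
    max (sawtoothIncrement (1 + δ n) h - 8 * (1 + δ n) * δ n) 0 with hl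
  have hlower : ∀ n w, Admissible (T n) (1 / δ n) (δ n) w → ∀ h,
      l n h ≤ meanSqIncrement (T n) w h := fun n w hw h => by
    obtain ⟨M, -, hM⟩ := hw.per.exists_forall_abs_le (hT0 n) hw.cont
    refine max_le ?_ (meanSqIncrement_nonneg (hT0 n) w h)
    have := hw.sawtoothIncrement_le (hT0 n) (hΛ n) (hδpos n) hM h
    rwa [hp] at this
  have hupper : ∀ n h, meanSqIncrement (T n) (v n) h ≤
      sawtoothIncrement (1 + δ n) h + 8 * (1 + δ n) * δ n := fun n h => by
    have := (hvadm n).meanSqIncrement_le_sawtoothIncrement (hT0 n) (hΛ n) (hδpos n) (hvM n)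
      (fun x y => by
        rw [hp]
        linarith [(hv01 n x).2, (hv01 n y).1, hδpos n]) h
    rwa [hp] at this
  have hvdom : ∀ n h, meanSqIncrement (T n) (v n) h ≤ 4 * min |h| 1 := fun n h => by
    have := meanSqIncrement_le (hvadm n).per (hT0 n) (hvadm n).cont.measurable (hvM n) le_rfl
      ((hvadm n).increment_structure (hT0 n) (hΛ n) (hδpos n)).1 h
    rwa [one_pow, mul_one] at this
  have hltend : ∀ h, Tendsto (fun n => l n h) atTop (𝓝 (sawtoothIncrement 1 h)) := fun h => by
    have h1 : Tendsto (fun n => l n h) atTop (𝓝 (max (sawtoothIncrement 1 h - 0) 0)) :=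
      ((tendsto_sawtoothIncrement hp1 h).sub herr).max tendsto_const_nhds
    rwa [sub_zero, max_eq_left] at h1
    rw [← meanSqIncrement_fract]
    exact meanSqIncrement_nonneg one_pos _ _
  have hvtend : ∀ h, Tendsto (fun n => meanSqIncrement (T n) (v n) h) atTop
      (𝓝 (sawtoothIncrement 1 h)) := fun h => by
    refine tendsto_of_tendsto_of_tendsto_of_le_of_le (hltend h) ?_
      (fun n => hlower n _ (hvadm n) h) (fun n => hupper n h)
    simpa using (tendsto_sawtoothIncrement hp1 h).add herr
  have hwdom : ∀ h, meanSqIncrement 1 Int.fract h ≤ 4 * min |h| 1 := fun h => by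
    rw [meanSqIncrement_fract]
    exact le_of_tendsto' (hvtend h) fun n => hvdom n h
  have hw := Fs_eq_integral_meanSqIncrement hs hs2 one_pos measurable_fract
    (M := 1) (fun x => by
      rw [Int.abs_fract]
      exact (Int.fract_lt_one x).le) hwdom
  have hgoal : (1 / 2) * ∫ x in Set.Ioo (0 : ℝ) 1, ∫ y : ℝ,
      (Int.fract x - Int.fract y) ^ 2 / |x - y| ^ (1 + 2 * s) =
      (1 / 2) * ∫ h : ℝ, sawtoothIncrement 1 h / |h| ^ (1 + 2 * s) := by
    have h1 := hw.2
    simp_rw [meanSqIncrement_fract] at h1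
    rw [← h1, Fs, mul_one]
  rw [hgoal]
  have hvF := fun n => Fs_eq_integral_meanSqIncrement hs hs2 (hT0 n) (hvadm n).cont.measurable
    (hvM n) (hvdom n)
  have hdom := (integrable_min_abs_one_div_rpow hs hs2).const_mul 4
  have hbound : ∀ g : ℝ → ℝ, ∀ h : ℝ, 0 ≤ g h → g h ≤ 4 * min |h| 1 →
      ‖g h / |h| ^ (1 + 2 * s)‖ ≤ 4 * (min |h| 1 / |h| ^ (1 + 2 * s)) := fun g h h0 h1 => by
    rw [Real.norm_of_nonneg (by positivity), ← mul_div_assoc]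
    gcongr
  have hlm : ∀ n, AEStronglyMeasurable fun h : ℝ => l n h / |h| ^ (1 + 2 * s) := fun n => by
    have := measurable_sawtoothIncrement (1 + δ n)
    exact Measurable.aestronglyMeasurable (by fun_prop)
  have hlbound : ∀ n h, ‖l n h / |h| ^ (1 + 2 * s)‖ ≤ 4 * (min |h| 1 / |h| ^ (1 + 2 * s)) :=
    fun n h => hbound _ h (le_max_right _ _) ((hlower n _ (hvadm n) h).trans (hvdom n h))
  refine tendsto_of_tendsto_of_tendsto_of_le_of_le
    (g := fun n => (1 / 2) * ∫ h : ℝ, l n h / |h| ^ (1 + 2 * s))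
    (h := fun n => Fs s (T n) (v n)) ?_ ?_ (fun n => ?_) (fun n => hmin n _ (hvadm n))
  · exact (tendsto_integral_of_dominated_convergence _ hlm hdom
      (fun n => Eventually.of_forall (hlbound n))
      (Eventually.of_forall fun h => (hltend h).div_const _)).const_mul _
  · refine Tendsto.congr (fun n => (hvF n).2.symm) ?_
    exact (tendsto_integral_of_dominated_convergence _
      (fun n => (hvF n).1.aestronglyMeasurable) hdom
      (fun n => Eventually.of_forall fun h =>
        hbound _ h (meanSqIncrement_nonneg (hT0 n) _ _) (hvdom n h))
      (Eventually.of_forall fun h => (hvtend h).div_const _)).const_mul _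
  · obtain ⟨M, hM1, hM⟩ := (hadm n).per.exists_forall_abs_le (hT0 n) (hadm n).cont
    have huF := Fs_eq_integral_meanSqIncrement hs hs2 (hT0 n) (hadm n).cont.measurable hM
      (meanSqIncrement_le (hadm n).per (hT0 n) (hadm n).cont.measurable hM hM1
        ((hadm n).increment_structure (hT0 n) (hΛ n) (hδpos n)).1)
    rw [huF.2]
    refine mul_le_mul_of_nonneg_left (integral_mono
      (hdom.mono' (hlm n) (Eventually.of_forall (hlbound n))) huF.1 fun h => ?_) (by norm_num)
    exact div_le_div_of_nonneg_right (hlower n _ (hadm n) h) (by positivity)
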